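/- Let a, b, c, d, e, f, g ∈ ℂ with e, f, g not equal to a nonpositive integer. Then the function u(x,y) = F1(a,b,c,d;e,f;g;x,y) satisfies, at every point of D = {(x,y) ∈ ℝ² : 0 < x < 1, 0 < y}, the third-order partial differential equation x²(1−x)·u_xxx + xy(2−x)·u_xxy + y²·u_xyy + x[e+f+1−(a+b+c+3)x]·u_xx + y[e+f+1−(b+c+1)x]·u_xy + (ef − [a(b+c+1)+(b+1)(c+1)]x)·u_x − bcy·u_y − abc·u = 0. -/

import Mathlib

noncomputable def poch (a : ℂ) (n : ℕ) : ℂ := ∏ i ∈ Finset.range n, (a + i)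

noncomputable def pdx (u : ℝ → ℝ → ℂ) : ℝ → ℝ → ℂ := fun x y => deriv (fun t => u t y) x
noncomputable def pdy (u : ℝ → ℝ → ℂ) : ℝ → ℝ → ℂ := fun x y => deriv (fun t => u x t) y

/-- Kampé de Fériet function of the fourth order. -/
noncomputable def F1 (a b c d e f g x y : ℂ) : ℂ :=
  ∑' p : ℕ × ℕ,
    poch a (p.1 + p.2) * poch b p.1 * poch c p.1 * poch d p.2 /
      (poch e (p.1 + p.2) * poch f (p.1 + p.2) * poch g p.2 *
        (Nat.factorial p.1 : ℂ) * (Nat.factorial p.2 : ℂ)) * x ^ p.1 * y ^ p.2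

/-- The coefficient family of the Kampé de Fériet series. -/
noncomputable def kdfCoeff (a b c d e f g : ℂ) (p : ℕ × ℕ) : ℂ :=
  poch a (p.1 + p.2) * poch b p.1 * poch c p.1 * poch d p.2 /
    (poch e (p.1 + p.2) * poch f (p.1 + p.2) * poch g p.2 *
      (Nat.factorial p.1 : ℂ) * (Nat.factorial p.2 : ℂ))

/-- The sum of a double power series with real arguments. -/
noncomputable def doubleSeries (E : ℕ × ℕ → ℂ) (x y : ℝ) : ℂ :=
  ∑' p : ℕ × ℕ, E p * (x : ℂ) ^ p.1 * (y : ℂ) ^ p.2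

/-- Coefficients of the formal partial derivative in the first variable. -/
def coeffDX (E : ℕ × ℕ → ℂ) (p : ℕ × ℕ) : ℂ := ((p.1 : ℂ) + 1) * E (p.1 + 1, p.2)

/-- Coefficients of the formal partial derivative in the second variable. -/
def coeffDY (E : ℕ × ℕ → ℂ) (p : ℕ × ℕ) : ℂ := ((p.2 : ℂ) + 1) * E (p.1, p.2 + 1)

/-- Absolute convergence of the double power series for `|x| < 1` and every `y`. -/
def ConvergesOnStrip (E : ℕ × ℕ → ℂ) : Prop :=
  ∀ x y : ℝ, 0 ≤ x → x < 1 → 0 ≤ y → Summable fun p : ℕ × ℕ => ‖E p‖ * x ^ p.1 * y ^ p.2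

lemma succ_mul_pow_mul_sub_le {r s : ℝ} (hr : 0 ≤ r) (hrs : r ≤ s) (n : ℕ) :
    (n + 1) * r ^ n * (s - r) + r ^ (n + 1) ≤ s ^ (n + 1) := by
  induction n with
  | zero => simp
  | succ n ih =>
    have h := mul_le_mul_of_nonneg_right ih (hr.trans hrs)
    have h2 : 0 ≤ (n + 1) * r ^ n * (s - r) ^ 2 := by positivity
    push_cast
    rw [pow_succ s (n + 1)]
    refine le_trans ?_ h
    rw [← sub_nonneg]
    linear_combination h2

lemma succ_mul_pow_le {r s : ℝ} (hr : 0 ≤ r) (hrs : r < s) (n : ℕ) :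
    (n + 1) * r ^ n ≤ (s - r)⁻¹ * s ^ (n + 1) := by
  have h := succ_mul_pow_mul_sub_le hr hrs.le n
  have h0 : 0 ≤ r ^ (n + 1) := by positivity
  rw [inv_mul_eq_div, le_div_iff₀ (sub_pos.2 hrs)]
  linarith

lemma mul_pow_pred_le {r s : ℝ} (hr : 0 ≤ r) (hrs : r < s) (n : ℕ) :
    n * r ^ (n - 1) ≤ (s - r)⁻¹ * s ^ n := by
  cases n with
  | zero => simpa using hrs.le
  | succ n => simpa using succ_mul_pow_le hr hrs n

lemma hasDerivAt_tsum_mul_pow {ι : Type*} (B : ι → ℂ) (k : ι → ℕ) {R : ℝ}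
    (hs : ∀ r : ℝ, 0 ≤ r → r < R → Summable fun i => ‖B i‖ * r ^ k i) {t : ℝ} (ht : |t| < R) :
    HasDerivAt (fun z : ℝ => ∑' i, B i * (z : ℂ) ^ k i)
      (∑' i, B i * ((k i : ℂ) * (t : ℂ) ^ (k i - 1))) t := by
  obtain ⟨r, htr, hrR⟩ := exists_between ht
  obtain ⟨s, hrs, hsR⟩ := exists_between hrR
  have hr : 0 ≤ r := (abs_nonneg t).trans htr.le
  refine hasDerivAt_tsum_of_isPreconnected
    (g' := fun i (z : ℝ) => B i * ((k i : ℂ) * (z : ℂ) ^ (k i - 1)))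
    ((hs s (hr.trans hrs.le) hsR).mul_left (s - r)⁻¹)
    (Metric.isOpen_ball (x := (0 : ℝ)) (ε := r)) (convex_ball 0 r).isPreconnected ?_ ?_
    (y₀ := t) (by simpa using htr) ?_ (by simpa using htr)
  · intro i z _
    exact ((hasDerivAt_pow (k i) (z : ℂ)).const_mul (B i)).comp_ofReal
  · intro i z hz
    have hz' : |z| ≤ r := by simpa using (mem_ball_zero_iff.1 hz).le
    rw [norm_mul, norm_mul, norm_pow, Complex.norm_real, Complex.norm_natCast, Real.norm_eq_abs]
    calc ‖B i‖ * (k i * |z| ^ (k i - 1)) ≤ ‖B i‖ * (k i * r ^ (k i - 1)) := by gcongr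
      _ ≤ ‖B i‖ * ((s - r)⁻¹ * s ^ k i) := 
        mul_le_mul_of_nonneg_left (mul_pow_pred_le hr hrs _) (norm_nonneg _)
      _ = (s - r)⁻¹ * (‖B i‖ * s ^ k i) := by ring
  · refine Summable.of_norm ?_
    simpa using hs |t| (abs_nonneg t) ht

lemma succFst_injective : Function.Injective fun p : ℕ × ℕ => (p.1 + 1, p.2) := by
  rintro ⟨a, b⟩ ⟨c, d⟩ h
  simpa using h

lemma succSnd_injective : Function.Injective fun p : ℕ × ℕ => (p.1, p.2 + 1) := by
  rintro ⟨a, b⟩ ⟨c, d⟩ h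
  simpa using h

lemma fst_eq_zero_of_notMem_range {p : ℕ × ℕ}
    (hp : p ∉ Set.range fun p : ℕ × ℕ => (p.1 + 1, p.2)) : p.1 = 0 := by
  by_contra h
  exact hp ⟨(p.1 - 1, p.2), by ext <;> simp; omega⟩

lemma snd_eq_zero_of_notMem_range {p : ℕ × ℕ}
    (hp : p ∉ Set.range fun p : ℕ × ℕ => (p.1, p.2 + 1)) : p.2 = 0 := by
  by_contra h
  exact hp ⟨(p.1, p.2 - 1), by ext <;> simp; omega⟩

namespace ConvergesOnStrip

variable {E : ℕ × ℕ → ℂ}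

lemma coeffDX (hE : ConvergesOnStrip E) : ConvergesOnStrip (coeffDX E) := by
  intro x y hx hx1 hy
  obtain ⟨s, hxs, hs1⟩ := exists_between hx1
  have h := (((hE s y (hx.trans hxs.le) hs1 hy).comp_injective succFst_injective).mul_left
    (s - x)⁻¹)
  refine Summable.of_nonneg_of_le (fun p => by positivity) (fun p => ?_) h
  have hn : ‖((p.1 : ℂ) + 1)‖ = (p.1 : ℝ) + 1 := by
    exact_mod_cast Complex.norm_natCast (p.1 + 1)
  simp only [_root_.coeffDX, norm_mul, hn, Function.comp]
  calc ((p.1 : ℝ) + 1) * ‖E (p.1 + 1, p.2)‖ * x ^ p.1 * y ^ p.2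
      = ‖E (p.1 + 1, p.2)‖ * (((p.1 : ℝ) + 1) * x ^ p.1) * y ^ p.2 := by ring
    _ ≤ ‖E (p.1 + 1, p.2)‖ * ((s - x)⁻¹ * s ^ (p.1 + 1)) * y ^ p.2 := by
      have hb := succ_mul_pow_le hx hxs p.1
      exact mul_le_mul_of_nonneg_right (mul_le_mul_of_nonneg_left hb (norm_nonneg _))
        (by positivity)
    _ = _ := by ring

lemma coeffDY (hE : ConvergesOnStrip E) : ConvergesOnStrip (coeffDY E) := by
  intro x y hx hx1 hy
  have h := (hE x (y + 1) hx hx1 (by positivity)).comp_injective succSnd_injective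
  refine Summable.of_nonneg_of_le (fun p => by positivity) (fun p => ?_) h
  have hn : ‖((p.2 : ℂ) + 1)‖ = (p.2 : ℝ) + 1 := by
    exact_mod_cast Complex.norm_natCast (p.2 + 1)
  have hb := succ_mul_pow_le hy (lt_add_one y) p.2
  simp only [add_sub_cancel_left, inv_one, one_mul] at hb
  simp only [_root_.coeffDY, norm_mul, hn, Function.comp]
  calc ((p.2 : ℝ) + 1) * ‖E (p.1, p.2 + 1)‖ * x ^ p.1 * y ^ p.2
      = ‖E (p.1, p.2 + 1)‖ * x ^ p.1 * (((p.2 : ℝ) + 1) * y ^ p.2) := by ring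
    _ ≤ ‖E (p.1, p.2 + 1)‖ * x ^ p.1 * (y + 1) ^ (p.2 + 1) := by gcongr

lemma hasSum (hE : ConvergesOnStrip E) {x : ℝ} (hx : |x| < 1) (y : ℝ) :
    HasSum (fun p : ℕ × ℕ => E p * (x : ℂ) ^ p.1 * (y : ℂ) ^ p.2) (doubleSeries E x y) := by
  refine (Summable.of_norm ?_).hasSum
  simpa using hE |x| |y| (abs_nonneg x) hx (abs_nonneg y)

lemma hasDerivAt_fst (hE : ConvergesOnStrip E) {x : ℝ} (hx : |x| < 1) (y : ℝ) :
    HasDerivAt (fun t => doubleSeries E t y) (doubleSeries (_root_.coeffDX E) x y) x := by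
  have h := hasDerivAt_tsum_mul_pow (fun p : ℕ × ℕ => E p * (y : ℂ) ^ p.2) Prod.fst (R := 1)
    (fun r hr hr1 => by simpa [mul_right_comm] using hE r |y| hr hr1 (abs_nonneg y)) hx
  convert h using 1
  · ext t
    exact tsum_congr fun p => by ring
  · rw [← succFst_injective.tsum_eq]
    · exact tsum_congr fun p => by simp [_root_.coeffDX]; ring
    · intro p hp
      by_contra h0
      exact hp (by simp [fst_eq_zero_of_notMem_range h0])

lemma hasDerivAt_snd (hE : ConvergesOnStrip E) {x : ℝ} (hx : |x| < 1) (y : ℝ) :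
    HasDerivAt (fun t => doubleSeries E x t) (doubleSeries (_root_.coeffDY E) x y) y := by
  have h := hasDerivAt_tsum_mul_pow (fun p : ℕ × ℕ => E p * (x : ℂ) ^ p.1) Prod.snd
    (fun r hr _ => by simpa using hE |x| r (abs_nonneg x) hx hr) (lt_add_one |y|)
  refine h.congr_deriv (Eq.symm ?_)
  rw [← succSnd_injective.tsum_eq]
  · exact tsum_congr fun p => by simp [_root_.coeffDY]; ring
  · intro p hp
    by_contra h0
    exact hp (by simp [snd_eq_zero_of_notMem_range h0])

lemma pdx_eq (hE : ConvergesOnStrip E) {w : ℝ → ℝ → ℂ}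
    (hw : ∀ x y, |x| < 1 → w x y = doubleSeries E x y) :
    ∀ x y, |x| < 1 → pdx w x y = doubleSeries (_root_.coeffDX E) x y := by
  intro x y hx
  refine ((hE.hasDerivAt_fst hx y).congr_of_eventuallyEq ?_).deriv
  filter_upwards [continuous_abs.continuousAt.eventually_lt continuousAt_const hx] with t ht
  exact hw t y ht

lemma pdy_eq (hE : ConvergesOnStrip E) {w : ℝ → ℝ → ℂ}
    (hw : ∀ x y, |x| < 1 → w x y = doubleSeries E x y) :
    ∀ x y, |x| < 1 → pdy w x y = doubleSeries (_root_.coeffDY E) x y := by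
  intro x y hx
  refine ((hE.hasDerivAt_snd hx y).congr_of_eventuallyEq ?_).deriv
  exact Filter.Eventually.of_forall fun t => hw x t hx

end ConvergesOnStrip

lemma HasSum.mul_fst {E : ℕ × ℕ → ℂ} {x y v : ℂ} (q : ℂ → ℂ → ℂ)
    (h : HasSum (fun p : ℕ × ℕ => q p.1 p.2 * (coeffDX E p * x ^ p.1 * y ^ p.2)) v) :
    HasSum (fun p : ℕ × ℕ => p.1 * q (p.1 - 1) p.2 * (E p * x ^ p.1 * y ^ p.2)) (x * v) := by
  rw [← succFst_injective.hasSum_iff]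
  · refine (congrArg (HasSum · (x * v)) (funext fun p => ?_)).mpr (h.mul_left x)
    simp only [coeffDX, Function.comp, Nat.cast_add, Nat.cast_one, add_sub_cancel_right]
    ring
  · intro p hp
    simp [fst_eq_zero_of_notMem_range hp]

lemma HasSum.mul_snd {E : ℕ × ℕ → ℂ} {x y v : ℂ} (q : ℂ → ℂ → ℂ)
    (h : HasSum (fun p : ℕ × ℕ => q p.1 p.2 * (coeffDY E p * x ^ p.1 * y ^ p.2)) v) :
    HasSum (fun p : ℕ × ℕ => p.2 * q p.1 (p.2 - 1) * (E p * x ^ p.1 * y ^ p.2)) (y * v) := by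
  rw [← succSnd_injective.hasSum_iff]
  · refine (congrArg (HasSum · (y * v)) (funext fun p => ?_)).mpr (h.mul_left y)
    simp only [coeffDY, Function.comp, Nat.cast_add, Nat.cast_one, add_sub_cancel_right]
    ring
  · intro p hp
    simp [snd_eq_zero_of_notMem_range hp]

lemma poch_succ (a : ℂ) (n : ℕ) : poch a (n + 1) = poch a n * (a + n) :=
  Finset.prod_range_succ _ _

lemma poch_one (n : ℕ) : poch 1 n = (n.factorial : ℂ) := by
  induction n with
  | zero => simp [poch]
  | succ n ih =>
    rw [poch_succ, ih, Nat.factorial_succ]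
    push_cast
    ring

lemma add_natCast_ne_zero {e : ℂ} (he : ∀ n : ℕ, e ≠ -(n : ℂ)) (n : ℕ) : e + n ≠ 0 :=
  fun h => he n (eq_neg_of_add_eq_zero_left h)

lemma poch_ne_zero {e : ℂ} (he : ∀ n : ℕ, e ≠ -(n : ℂ)) (n : ℕ) : poch e n ≠ 0 :=
  Finset.prod_ne_zero_iff.2 fun i _ => add_natCast_ne_zero he i

lemma eventually_norm_add_natCast_le (a e : ℂ) {r : ℝ} (hr : 1 < r) :
    ∃ N : ℕ, ∀ n ≥ N, ‖a + n‖ ≤ r * ‖e + n‖ := by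
  obtain ⟨N, hN⟩ := exists_nat_ge (‖e‖ + ‖a - e‖ / (r - 1))
  refine ⟨N, fun n hn => ?_⟩
  have hr0 : 0 < r - 1 := sub_pos.2 hr
  have h1 : (n : ℝ) ≤ ‖e + n‖ + ‖e‖ := by
    have h := norm_sub_le (e + n) e
    rwa [add_sub_cancel_left, Complex.norm_natCast] at h
  have h2 : ‖a + n‖ ≤ ‖a - e‖ + ‖e + n‖ := by
    have h := norm_add_le (a - e) (e + n)
    rwa [show a - e + (e + n) = a + n by ring] at h
  have hnN : (N : ℝ) ≤ n := by exact_mod_cast hn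
  have h3 : ‖a - e‖ / (r - 1) ≤ ‖e + n‖ := by linarith
  rw [div_le_iff₀ hr0] at h3
  linarith

lemma exists_norm_poch_le (a : ℂ) {e : ℂ} (he : ∀ n : ℕ, e ≠ -(n : ℂ)) {r : ℝ} (hr : 1 < r) :
    ∃ C : ℝ, 0 ≤ C ∧ ∀ n, ‖poch a n‖ ≤ C * r ^ n * ‖poch e n‖ := by
  obtain ⟨N, hN⟩ := eventually_norm_add_natCast_le a e hr
  have hr0 : 0 < r := one_pos.trans hr
  have hpos : ∀ n, 0 < r ^ n * ‖poch e n‖ := fun n =>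
    mul_pos (pow_pos hr0 n) (norm_pos_iff.2 (poch_ne_zero he n))
  have hterm : ∀ n, 0 ≤ ‖poch a n‖ / (r ^ n * ‖poch e n‖) := fun n =>
    div_nonneg (norm_nonneg _) (hpos n).le
  refine ⟨∑ k ∈ Finset.range (N + 1), ‖poch a k‖ / (r ^ k * ‖poch e k‖),
    Finset.sum_nonneg fun k _ => hterm k, fun n => ?_⟩
  set C := ∑ k ∈ Finset.range (N + 1), ‖poch a k‖ / (r ^ k * ‖poch e k‖)
  have hsmall : ∀ n ≤ N, ‖poch a n‖ ≤ C * r ^ n * ‖poch e n‖ := by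
    intro n hn
    rw [mul_assoc, ← div_le_iff₀ (hpos n)]
    exact Finset.single_le_sum (f := fun k => ‖poch a k‖ / (r ^ k * ‖poch e k‖))
      (fun k _ => hterm k) (Finset.mem_range.2 (by omega))
  rcases le_total n N with hn | hn
  · exact hsmall n hn
  · induction n, hn using Nat.le_induction with
    | base => exact hsmall N le_rfl
    | succ n hn ih =>
      rw [poch_succ, poch_succ, norm_mul, norm_mul]
      calc ‖poch a n‖ * ‖a + n‖ ≤ (C * r ^ n * ‖poch e n‖) * (r * ‖e + n‖) :=
            mul_le_mul ih (hN n hn) (norm_nonneg _) ((norm_nonneg _).trans ih)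
        _ = _ := by ring

lemma exists_norm_kdfCoeff_le (a b c d : ℂ) {e f g : ℂ} (he : ∀ n : ℕ, e ≠ -(n : ℂ))
    (hf : ∀ n : ℕ, f ≠ -(n : ℂ)) (hg : ∀ n : ℕ, g ≠ -(n : ℂ)) {r : ℝ} (hr : 1 < r) :
    ∃ C : ℝ, 0 ≤ C ∧ ∀ p : ℕ × ℕ,
      ‖kdfCoeff a b c d e f g p‖ ≤ C * ((r ^ 4) ^ p.1 * ((r ^ 3) ^ p.2 / p.2.factorial)) := by
  have h1 : ∀ n : ℕ, (1 : ℂ) ≠ -(n : ℂ) := fun n h => by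
    have := congrArg Complex.re h
    simp at this
    linarith [Nat.cast_nonneg (α := ℝ) n]
  obtain ⟨A, hA, hA'⟩ := exists_norm_poch_le a he hr
  obtain ⟨B, hB, hB'⟩ := exists_norm_poch_le b h1 hr
  obtain ⟨K, hK, hK'⟩ := exists_norm_poch_le c h1 hr
  obtain ⟨D, hD, hD'⟩ := exists_norm_poch_le d hg hr
  obtain ⟨F, hF, hF'⟩ := exists_norm_poch_le 1 hf hr
  have hr0 : 0 < r := one_pos.trans hr
  refine ⟨A * B * K * D * F, by positivity, fun ⟨m, n⟩ => ?_⟩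
  simp only [poch_one, Complex.norm_natCast] at hB' hK' hF'
  have hepos := norm_pos_iff.2 (poch_ne_zero he (m + n))
  have hfpos := norm_pos_iff.2 (poch_ne_zero hf (m + n))
  have hgpos := norm_pos_iff.2 (poch_ne_zero hg n)
  have hm : (0 : ℝ) < m.factorial := by positivity
  have hn : (0 : ℝ) < n.factorial := by positivity
  have hmn : (m.factorial : ℝ) ≤ F * r ^ (m + n) * ‖poch f (m + n)‖ :=
    le_trans (by exact_mod_cast Nat.factorial_le (Nat.le_add_right m n)) (hF' (m + n))
  simp only [kdfCoeff, norm_div, norm_mul, Complex.norm_natCast]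
  rw [div_le_iff₀ (by positivity)]
  calc ‖poch a (m + n)‖ * ‖poch b m‖ * ‖poch c m‖ * ‖poch d n‖
      ≤ (A * r ^ (m + n) * ‖poch e (m + n)‖) * (B * r ^ m * m.factorial) *
          (K * r ^ m * m.factorial) * (D * r ^ n * ‖poch g n‖) := by
        gcongr
        exacts [hA' _, hB' _, hK' _, hD' _]
    _ ≤ (A * r ^ (m + n) * ‖poch e (m + n)‖) * (B * r ^ m * m.factorial) *
          (K * r ^ m * (F * r ^ (m + n) * ‖poch f (m + n)‖)) * (D * r ^ n * ‖poch g n‖) := by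
        gcongr
    _ = _ := by
        field_simp
        ring

lemma convergesOnStrip_kdfCoeff (a b c d : ℂ) {e f g : ℂ} (he : ∀ n : ℕ, e ≠ -(n : ℂ))
    (hf : ∀ n : ℕ, f ≠ -(n : ℂ)) (hg : ∀ n : ℕ, g ≠ -(n : ℂ)) :
    ConvergesOnStrip (kdfCoeff a b c d e f g) := by
  intro x y hx hx1 hy
  have hcont : ContinuousAt (fun r : ℝ => r ^ 4 * x) 1 := by fun_prop
  obtain ⟨r, hrx, hr⟩ : ∃ r : ℝ, r ^ 4 * x < 1 ∧ 1 < r :=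
    (((hcont.eventually_lt continuousAt_const (by simpa using hx1)).filter_mono
      nhdsWithin_le_nhds).and (self_mem_nhdsWithin (s := Set.Ioi (1 : ℝ)))).exists
  obtain ⟨C, hC, hbound⟩ := exists_norm_kdfCoeff_le a b c d he hf hg hr
  have hr0 : 0 < r := one_pos.trans hr
  have hgeom := summable_geometric_of_lt_one (by positivity : 0 ≤ r ^ 4 * x) hrx
  have hexp := Real.summable_pow_div_factorial (r ^ 3 * y)
  refine Summable.of_nonneg_of_le (fun p => by positivity) (fun p => ?_)
    ((hgeom.mul_of_nonneg hexp (fun _ => by positivity) fun _ => by positivity).mul_left C)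
  calc ‖kdfCoeff a b c d e f g p‖ * x ^ p.1 * y ^ p.2
      ≤ C * ((r ^ 4) ^ p.1 * ((r ^ 3) ^ p.2 / p.2.factorial)) * x ^ p.1 * y ^ p.2 := by
        gcongr
        exact hbound p
    _ = _ := by
        rw [mul_pow, mul_pow]
        ring

lemma coeffDX_kdfCoeff (a b c d : ℂ) {e f g : ℂ} (he : ∀ n : ℕ, e ≠ -(n : ℂ))
    (hf : ∀ n : ℕ, f ≠ -(n : ℂ)) (hg : ∀ n : ℕ, g ≠ -(n : ℂ)) (p : ℕ × ℕ) :
    (e + p.1 + p.2) * (f + p.1 + p.2) * coeffDX (kdfCoeff a b c d e f g) p =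
      (a + p.1 + p.2) * (b + p.1) * (c + p.1) * kdfCoeff a b c d e f g p := by
  obtain ⟨m, n⟩ := p
  have he' : e + m + n ≠ 0 := by simpa [add_assoc] using add_natCast_ne_zero he (m + n)
  have hf' : f + m + n ≠ 0 := by simpa [add_assoc] using add_natCast_ne_zero hf (m + n)
  have hm : (m : ℂ) + 1 ≠ 0 := by exact_mod_cast m.succ_ne_zero
  simp only [coeffDX, kdfCoeff, show m + 1 + n = m + n + 1 by ring, poch_succ,
    Nat.factorial_succ]
  push_cast
  simp only [← add_assoc]
  have hpe := poch_ne_zero he (m + n)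
  have hpf := poch_ne_zero hf (m + n)
  have hpg := poch_ne_zero hg n
  have hmf : (m.factorial : ℂ) ≠ 0 := by exact_mod_cast m.factorial_ne_zero
  have hnf : (n.factorial : ℂ) ≠ 0 := by exact_mod_cast n.factorial_ne_zero
  rw [← mul_assoc, mul_div_assoc', mul_div_assoc', div_eq_div_iff (by simp [*]) (by simp [*])]
  ring

theorem stmt0(a b c d e f g : ℂ)
    (he : ∀ n : ℕ, e ≠ -(n : ℂ)) (hf : ∀ n : ℕ, f ≠ -(n : ℂ)) (hg : ∀ n : ℕ, g ≠ -(n : ℂ))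
    (u : ℝ → ℝ → ℂ)
    (hu : u = fun x y : ℝ => F1 a b c d e f g (x : ℂ) (y : ℂ)) :
    ∀ x y : ℝ, 0 < x → x < 1 → 0 < y →
      (x : ℂ) ^ 2 * (1 - (x : ℂ)) * pdx (pdx (pdx u)) x y
        + (x : ℂ) * (y : ℂ) * (2 - (x : ℂ)) * pdy (pdx (pdx u)) x y
        + (y : ℂ) ^ 2 * pdy (pdy (pdx u)) x y
        + (x : ℂ) * (e + f + 1 - (a + b + c + 3) * (x : ℂ)) * pdx (pdx u) x y
        + (y : ℂ) * (e + f + 1 - (b + c + 1) * (x : ℂ)) * pdy (pdx u) x y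
        + (e * f - (a * (b + c + 1) + (b + 1) * (c + 1)) * (x : ℂ)) * pdx u x y
        - b * c * (y : ℂ) * pdy u x y - a * b * c * u x y = 0 := by
  intro x y hx hx1 _
  have hx' : |x| < 1 := by rwa [abs_of_pos hx]
  set A := kdfCoeff a b c d e f g with hA
  have gA : ConvergesOnStrip A := convergesOnStrip_kdfCoeff a b c d he hf hg
  have eA : ∀ x y, |x| < 1 → u x y = doubleSeries A x y := by
    intro x y _
    rw [hu]
    rfl
  have eX := gA.pdx_eq eA
  have eXX := gA.coeffDX.pdx_eq eX
  have one {E : ℕ × ℕ → ℂ} (hE : ConvergesOnStrip E) {w : ℝ → ℝ → ℂ}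
      (hw : ∀ x y, |x| < 1 → w x y = doubleSeries E x y) :
      HasSum (fun p : ℕ × ℕ => 1 * (E p * (x : ℂ) ^ p.1 * (y : ℂ) ^ p.2)) (w x y) := by
    simpa [hw x y hx'] using hE.hasSum hx' y
  have s := one gA eA
  have sX := one gA.coeffDX eX
  have sY := (one gA.coeffDY (gA.pdy_eq eA)).mul_snd fun _ _ => 1
  have sXX := (one gA.coeffDX.coeffDX eXX).mul_fst fun _ _ => 1
  have sXY := (one gA.coeffDX.coeffDY (gA.coeffDX.pdy_eq eX)).mul_snd fun _ _ => 1
  have sXXX := ((one gA.coeffDX.coeffDX.coeffDX (gA.coeffDX.coeffDX.pdx_eq eXX)).mul_fst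
    fun _ _ => 1).mul_fst fun m _ => m * 1
  have sXXY := ((one gA.coeffDX.coeffDX.coeffDY (gA.coeffDX.coeffDX.pdy_eq eXX)).mul_snd
    fun _ _ => 1).mul_fst fun _ n => n * 1
  have sXYY := ((one gA.coeffDX.coeffDY.coeffDY
    (gA.coeffDX.coeffDY.pdy_eq (gA.coeffDX.pdy_eq eX))).mul_snd fun _ _ => 1).mul_snd
    fun _ n => n * 1
  have tX := sX.mul_fst fun _ _ => 1
  have tXX := sXX.mul_fst fun m _ => m * 1
  have tXY := sXY.mul_fst fun _ n => n * 1
  have tXXX := sXXX.mul_fst fun m _ => m * ((m - 1) * 1)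
  have tXXY := sXXY.mul_fst fun m n => m * (n * 1)
  have lower := ((sXXX.add (sXXY.mul_left 2)).add sXYY).add
    (((sXX.add sXY).mul_left (e + f + 1)).add (sX.mul_left (e * f)))
  have upper := ((tXXX.add tXXY).add ((tXX.mul_left (a + b + c + 3)).add
    (tXY.mul_left (b + c + 1)))).add
    (((tX.mul_left (a * (b + c + 1) + (b + 1) * (c + 1))).add (sY.mul_left (b * c))).add
      (s.mul_left (a * b * c)))
  refine Eq.trans ?_ ((lower.sub upper).unique ?_)
  · ring
  · convert hasSum_zero using 2 with p
    have h := coeffDX_kdfCoeff a b c d he hf hg p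
    rw [← hA] at h
    linear_combination (x : ℂ) ^ p.1 * (y : ℂ) ^ p.2 * h
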